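/- For every integer r ≥ 1 and every real x with 0 < x < 1, the (2r−1)-th iterated derivative of the real cotangent function t ↦ cos t / sin t, evaluated at t = πx, equals −π^{−2r}·(Ψ_{2r−1}(x) + Ψ_{2r−1}(1 − x)), and this quantity is strictly negative. -/

import Mathlib

open Real

/-- The digamma function `Ψ = Γ'/Γ`. -/
noncomputable def digamma (x : ℝ) : ℝ := deriv Real.Gamma x / Real.Gamma x

/-- The polygamma function of order `m`: the `m`-th derivative of the digamma function. -/
noncomputable def polygamma (m : ℕ) (x : ℝ) : ℝ := iteratedDeriv m digamma x

open Polynomial in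
theorem Polynomial.aeval_nat_nonneg (S : ℕ[X]) {y : ℝ} (hy : 0 ≤ y) : 0 ≤ aeval y S := by
  rw [aeval_eq_sum_range]
  exact Finset.sum_nonneg fun i _ => by positivity

theorem iteratedDeriv_comp_mul_left {𝕜 : Type*} [NontriviallyNormedField 𝕜] (n : ℕ) (f : 𝕜 → 𝕜)
    (c : 𝕜) : iteratedDeriv n (fun x => f (c * x)) = fun x => c ^ n * iteratedDeriv n f (c * x) := by
  induction n with
  | zero => simp
  | succ n ih =>
    funext x
    rw [iteratedDeriv_succ, ih, deriv_const_mul_field, iteratedDeriv_succ,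
      deriv_comp_mul_left c (iteratedDeriv n f) x, smul_eq_mul, pow_succ, mul_assoc]

theorem hasDerivAt_cos_div_sin {t : ℝ} (ht : Real.sin t ≠ 0) :
    HasDerivAt (fun t : ℝ => Real.cos t / Real.sin t)
      (-(1 + (Real.cos t / Real.sin t) ^ 2)) t := by
  refine ((Real.hasDerivAt_cos t).div (Real.hasDerivAt_sin t) ht).congr_deriv ?_
  field_simp
  ring

theorem contDiffAt_cos_div_sin {n : WithTop ℕ∞} {t : ℝ} (ht : Real.sin t ≠ 0) :
    ContDiffAt ℝ n (fun t : ℝ => Real.cos t / Real.sin t) t :=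
  Real.contDiff_cos.contDiffAt.div Real.contDiff_sin.contDiffAt ht

open Polynomial in
/-- On `(0, π)` every odd derivative of `cot` is `-(1 + c² + S(c²))` with `c = cot t`, where `S` is
a polynomial with natural coefficients. -/
theorem exists_iteratedDeriv_odd_cot_eq (m : ℕ) : ∃ S : ℕ[X], ∀ t ∈ Set.Ioo 0 π,
    iteratedDeriv (2 * m + 1) (fun t : ℝ => Real.cos t / Real.sin t) t =
      -(1 + (Real.cos t / Real.sin t) ^ 2 + aeval ((Real.cos t / Real.sin t) ^ 2) S) := by
  have hsin : ∀ t ∈ Set.Ioo 0 π, Real.sin t ≠ 0 := fun t ht =>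
    (Real.sin_pos_of_pos_of_lt_pi ht.1 ht.2).ne'
  have hstep : ∀ (n : ℕ) (p q : ℝ → ℝ),
      (∀ t ∈ Set.Ioo 0 π, iteratedDeriv n (fun t : ℝ => Real.cos t / Real.sin t) t =
        p (Real.cos t / Real.sin t)) →
      (∀ c, HasDerivAt p (q c) c) → ∀ t ∈ Set.Ioo 0 π,
      iteratedDeriv (n + 1) (fun t : ℝ => Real.cos t / Real.sin t) t =
        q (Real.cos t / Real.sin t) * -(1 + (Real.cos t / Real.sin t) ^ 2) := by
    intro n p q h hp t ht
    have h_eq : iteratedDeriv n (fun t : ℝ => Real.cos t / Real.sin t) =ᶠ[nhds t]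
        fun t => p (Real.cos t / Real.sin t) := by
      filter_upwards [isOpen_Ioo.mem_nhds ht] with s hs using h s hs
    rw [iteratedDeriv_succ, h_eq.deriv_eq]
    exact ((hp _).comp t (hasDerivAt_cos_div_sin (hsin t ht))).deriv
  induction m with
  | zero =>
    refine ⟨0, fun t ht => ?_⟩
    simpa using (hasDerivAt_cos_div_sin (hsin t ht)).deriv
  | succ m ih =>
    obtain ⟨S, hS⟩ := ih
    let D := derivative S
    let E := derivative D
    have hSD : ∀ c : ℝ, HasDerivAt (fun c => aeval (c ^ 2) S) (aeval (c ^ 2) D * (2 * c)) c :=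
      fun c => by
        simpa using! (S.hasDerivAt_aeval (c ^ 2)).comp c (hasDerivAt_pow 2 c)
    have hDE : ∀ c : ℝ, HasDerivAt (fun c => aeval (c ^ 2) D) (aeval (c ^ 2) E * (2 * c)) c :=
      fun c => by
        simpa using! (D.hasDerivAt_aeval (c ^ 2)).comp c (hasDerivAt_pow 2 c)
    have hsq : ∀ c : ℝ, HasDerivAt (fun c : ℝ => c ^ 2) (2 * c) c := fun c => by
      simpa using hasDerivAt_pow 2 c
    have h1 := hstep (2 * m + 1) (fun c => -(1 + c ^ 2 + aeval (c ^ 2) S))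
      (fun c => -(2 * c + aeval (c ^ 2) D * (2 * c))) hS
      (fun c => (((hsq c).const_add 1).add (hSD c)).neg)
    have h2 := hstep (2 * m + 1 + 1)
      (fun c => -(2 * c + aeval (c ^ 2) D * (2 * c)) * -(1 + c ^ 2))
      (fun c => -(2 * 1 + (aeval (c ^ 2) E * (2 * c) * (2 * c) + aeval (c ^ 2) D * (2 * 1))) *
        -(1 + c ^ 2) + -(2 * c + aeval (c ^ 2) D * (2 * c)) * -(2 * c)) h1
      (fun c => ((((hasDerivAt_id c).const_mul 2).add
        ((hDE c).mul ((hasDerivAt_id c).const_mul 2))).neg).mul (((hsq c).const_add 1).neg))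
    refine ⟨1 + 3 * X + 2 * X ^ 2 + 2 * (1 + X) ^ 2 * D
      + 4 * X * (1 + X) * (1 + D + (1 + X) * E), fun t ht => ?_⟩
    rw [show 2 * (m + 1) + 1 = 2 * m + 1 + 1 + 1 by ring, h2 t ht]
    simp only [map_add, map_mul, map_pow, map_one, map_ofNat, aeval_X]
    ring

theorem iteratedDeriv_odd_cot_neg (m : ℕ) {t : ℝ} (ht : t ∈ Set.Ioo 0 π) :
    iteratedDeriv (2 * m + 1) (fun t : ℝ => Real.cos t / Real.sin t) t < 0 := by
  obtain ⟨S, hS⟩ := exists_iteratedDeriv_odd_cot_eq m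
  rw [hS t ht]
  have := S.aeval_nat_nonneg (sq_nonneg (Real.cos t / Real.sin t))
  have := sq_nonneg (Real.cos t / Real.sin t)
  linarith

theorem Real.contDiffAt_Gamma {n : WithTop ℕ∞} {x : ℝ} (hx : 0 < x) :
    ContDiffAt ℝ n Real.Gamma x := by
  have h0 : (Complex.Gamma x)⁻¹ ≠ 0 :=
    inv_ne_zero (Complex.Gamma_ne_zero_of_re_pos (by simpa using hx))
  have h := (Complex.differentiable_one_div_Gamma.contDiff.contDiffAt (n := n)).inv h0
  simpa [Complex.Gamma_ofReal] using h.real_of_complex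

theorem contDiffAt_digamma {n : ℕ} {x : ℝ} (hx : 0 < x) : ContDiffAt ℝ n digamma x :=
  ((Real.contDiffAt_Gamma (n := (n : WithTop ℕ∞) + 1) hx).derivWithin le_rfl).div
    (Real.contDiffAt_Gamma hx) (Real.Gamma_pos_of_pos hx).ne'

theorem digamma_sub_digamma_one_sub {x : ℝ} (hx0 : 0 < x) (hx1 : x < 1) :
    digamma x - digamma (1 - x) = -(π * (Real.cos (π * x) / Real.sin (π * x))) := by
  have hs : Real.sin (π * x) ≠ 0 := (Real.sin_pos_of_pos_of_lt_pi (by positivity)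
    (by nlinarith [Real.pi_pos])).ne'
  have hG {y : ℝ} (hy : 0 < y) : DifferentiableAt ℝ Real.Gamma y :=
    (Real.contDiffAt_Gamma (n := 1) hy).differentiableAt one_ne_zero
  have hy : 0 < 1 - x := by linarith
  have hd : HasDerivAt (fun s => Real.sin (π * s)) (Real.cos (π * x) * π) x := by
    simpa using ((hasDerivAt_id x).const_mul π).sin
  have h : logDeriv (fun s => Real.Gamma s * Real.Gamma (1 - s)) x =
      logDeriv (fun s => π / Real.sin (π * s)) x := by
    simp only [Real.Gamma_mul_Gamma_one_sub]
  rw [logDeriv_mul (g := fun s => Real.Gamma (1 - s)) x (Real.Gamma_pos_of_pos hx0).ne' (Real.Gamma_pos_of_pos hy).ne' (hG hx0)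
      ((hG hy).comp x (by fun_prop)),
    logDeriv_div x Real.pi_ne_zero hs (by fun_prop) hd.differentiableAt] at h
  simp only [logDeriv_apply, deriv_comp_const_sub, hd.deriv, deriv_const] at h
  simp only [digamma]
  linear_combination h

theorem iteratedDeriv_cot_eq_neg_polygamma (r : ℕ) (hr : 1 ≤ r) (x : ℝ)
    (hx0 : 0 < x) (hx1 : x < 1) :
    iteratedDeriv (2 * r - 1) (fun t : ℝ => Real.cos t / Real.sin t) (π * x)
        = -(polygamma (2 * r - 1) x + polygamma (2 * r - 1) (1 - x)) / π ^ (2 * r) ∧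
    -(polygamma (2 * r - 1) x + polygamma (2 * r - 1) (1 - x)) / π ^ (2 * r) < 0 := by
  obtain ⟨m, rfl⟩ : ∃ m, r = m + 1 := ⟨r - 1, by omega⟩
  have hn : 2 * (m + 1) - 1 = 2 * m + 1 := by omega
  have ht : π * x ∈ Set.Ioo 0 π := ⟨by positivity, by nlinarith [Real.pi_pos]⟩
  have h_eq : digamma - (fun s => digamma (1 - s)) =ᶠ[nhds x]
      fun s => -(π * (Real.cos (π * s) / Real.sin (π * s))) := by
    filter_upwards [isOpen_Ioo.mem_nhds (Set.mem_Ioo.2 ⟨hx0, hx1⟩)] with s hs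
    exact digamma_sub_digamma_one_sub hs.1 hs.2
  have h := h_eq.iteratedDeriv_eq (2 * m + 1)
  have hc : ContDiffAt ℝ (2 * m + 1 : ℕ) (fun s => digamma (1 - s)) x :=
    (contDiffAt_digamma (by linarith : 0 < 1 - x)).comp x (by fun_prop)
  rw [iteratedDeriv_sub (contDiffAt_digamma hx0) hc, iteratedDeriv_comp_const_sub,
    iteratedDeriv_fun_neg, iteratedDeriv_const_mul_field,
    iteratedDeriv_comp_mul_left _ (fun t => Real.cos t / Real.sin t)] at h
  have key : iteratedDeriv (2 * m + 1) (fun t : ℝ => Real.cos t / Real.sin t) (π * x)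
      = -(polygamma (2 * m + 1) x + polygamma (2 * m + 1) (1 - x)) / π ^ (2 * (m + 1)) := by
    have hodd : (-1 : ℝ) ^ (2 * m + 1) = -1 := Odd.neg_one_pow ⟨m, rfl⟩
    simp only [hodd, smul_eq_mul] at h
    rw [eq_div_iff (by positivity)]
    simp only [polygamma]
    linear_combination h
  rw [hn, ← key]
  exact ⟨rfl, iteratedDeriv_odd_cot_neg m ht⟩
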